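/- Let A, B ∈ F_2^m be nonzero with supp(A) ∩ supp(B) = ∅, let D = (Δ_A ∪ Δ_B) \ {0}, and let u ∈ F_2^m. Then the Hamming weight of the codeword c_u = (u·g)_{g ∈ D} equals 2^{|A|−1}(1 − χ(u|A)) + 2^{|B|−1}(1 − χ(u|B)). -/

import Mathlib

open Finset

def supp {m : ℕ} (v : Fin m → ZMod 2) : Finset (Fin m) :=
  Finset.univ.filter fun i => v i ≠ 0

def wt {m : ℕ} (v : Fin m → ZMod 2) : ℕ := (supp v).card

def delta {m : ℕ} (A : Fin m → ZMod 2) : Finset (Fin m → ZMod 2) :=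
  Finset.univ.filter fun v => supp v ⊆ supp A

def deltaT {m : ℕ} (T : Finset (Fin m)) : Finset (Fin m → ZMod 2) :=
  Finset.univ.filter fun v => supp v ⊆ T

def hwt {ι : Type*} [Fintype ι] (c : ι → ZMod 2) : ℕ :=
  (Finset.univ.filter fun i => c i ≠ 0).card

def cw {m : ℕ} (D : Finset (Fin m → ZMod 2)) (u : Fin m → ZMod 2) : ↥D → ZMod 2 :=
  fun g => ∑ i, u i * (g : Fin m → ZMod 2) i

def codeC {m : ℕ} (D : Finset (Fin m → ZMod 2)) :
    Submodule (ZMod 2) (↥D → ZMod 2) :=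
  LinearMap.range (Matrix.mulVecLin (Matrix.of fun (g : ↥D) (i : Fin m) => (g : Fin m → ZMod 2) i))

def dualCode {ι : Type*} [Fintype ι] (C : Submodule (ZMod 2) (ι → ZMod 2)) :
    Submodule (ZMod 2) (ι → ZMod 2) where
  carrier := {w | ∀ c ∈ C, ∑ i, w i * c i = 0}
  zero_mem' := by simp
  add_mem' := by
    intro a b ha hb c hc
    have h := congrArg₂ (· + ·) (ha c hc) (hb c hc)
    simpa [add_mul, Finset.sum_add_distrib] using h
  smul_mem' := by
    intro r w hw c hc
    have h := congrArg (r * ·) (hw c hc)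
    simpa [Finset.mul_sum, mul_assoc] using h

def isMinDist {ι : Type*} [Fintype ι] (C : Set (ι → ZMod 2)) (d : ℕ) : Prop :=
  (∃ c ∈ C, c ≠ 0 ∧ hwt c = d) ∧ ∀ c ∈ C, c ≠ 0 → d ≤ hwt c

def chi {m : ℕ} (u v : Fin m → ZMod 2) : ℤ :=
  if supp u ∩ supp v = ∅ then 1 else 0

theorem mem_supp {m : ℕ} {v : Fin m → ZMod 2} {i : Fin m} : i ∈ supp v ↔ v i ≠ 0 := by
  simp [supp]

theorem mem_delta {m : ℕ} {A v : Fin m → ZMod 2} : v ∈ delta A ↔ supp v ⊆ supp A := by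
  simp [delta]

theorem ZMod.two_eq_zero_or_eq_one (x : ZMod 2) : x = 0 ∨ x = 1 := by
  revert x; decide

theorem card_delta {m : ℕ} (A : Fin m → ZMod 2) : (delta A).card = 2 ^ wt A := by
  rw [wt, ← Finset.card_powerset]
  refine Finset.card_nbij' supp (fun s i => if i ∈ s then 1 else 0) ?_ ?_ ?_ ?_
  · intro v hv
    simpa [delta] using hv
  · intro s hs
    have hs' : s ⊆ supp A := by simpa using hs
    refine mem_delta.2 fun i hi => hs' ?_
    simpa [mem_supp] using hi
  · intro v _
    funext i
    rcases ZMod.two_eq_zero_or_eq_one (v i) with h | h <;> simp [mem_supp, h]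
  · intro s _
    ext i
    simp [mem_supp]

theorem dotProduct_eq_zero_of_supp_disjoint {m : ℕ} {u v : Fin m → ZMod 2}
    (h : supp u ∩ supp v = ∅) : u ⬝ᵥ v = 0 := by
  refine Finset.sum_eq_zero fun i _ => ?_
  by_contra hi
  have : i ∈ supp u ∩ supp v :=
    Finset.mem_inter.2 ⟨mem_supp.2 (left_ne_zero_of_mul hi), mem_supp.2 (right_ne_zero_of_mul hi)⟩
  simp [h] at this

theorem add_single_mem_delta {m : ℕ} {A v : Fin m → ZMod 2} {i : Fin m} (hi : i ∈ supp A)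
    (hv : v ∈ delta A) : v + Pi.single i 1 ∈ delta A := by
  refine mem_delta.2 fun j hj => ?_
  by_cases hji : j = i
  · exact hji ▸ hi
  · refine mem_delta.1 hv (mem_supp.2 ?_)
    simpa [mem_supp, hji] using hj

theorem add_single_add_single {m : ℕ} (v : Fin m → ZMod 2) (i : Fin m) :
    v + Pi.single i 1 + Pi.single i 1 = v := by
  rw [add_assoc, ← Pi.single_add, CharTwo.add_self_eq_zero, Pi.single_zero, add_zero]

theorem card_filter_dotProduct_ne_zero {m : ℕ} (A u : Fin m → ZMod 2) :
    (((delta A).filter fun v => u ⬝ᵥ v ≠ 0).card : ℤ) = 2 ^ (wt A - 1) * (1 - chi u A) := by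
  by_cases h : supp u ∩ supp A = ∅
  · have : ((delta A).filter fun v => u ⬝ᵥ v ≠ 0) = ∅ := by
      refine Finset.filter_eq_empty_iff.2 fun v hv => not_not.2 ?_
      refine dotProduct_eq_zero_of_supp_disjoint (Finset.subset_empty.1 ?_)
      exact h ▸ Finset.inter_subset_inter_left (mem_delta.1 hv)
    simp [this, chi, h]
  · obtain ⟨i, hi⟩ := Finset.nonempty_iff_ne_empty.2 h
    obtain ⟨hu, hA⟩ := Finset.mem_inter.1 hi
    have hui : u i = 1 := (ZMod.two_eq_zero_or_eq_one _).resolve_left (mem_supp.1 hu)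
    have hflip (v : Fin m → ZMod 2) : u ⬝ᵥ (v + Pi.single i 1) = u ⬝ᵥ v + 1 := by
      simp [dotProduct_add, hui]
    have hhalf : ((delta A).filter fun v => u ⬝ᵥ v = 0).card =
        ((delta A).filter fun v => ¬ u ⬝ᵥ v = 0).card := by
      refine Finset.card_nbij' (· + Pi.single i 1) (· + Pi.single i 1) ?_ ?_
        (fun v _ => add_single_add_single v i) (fun v _ => add_single_add_single v i)
      · intro v hv
        obtain ⟨hv, h0⟩ := Finset.mem_filter.1 hv
        refine Finset.mem_filter.2 ⟨add_single_mem_delta hA hv, ?_⟩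
        rw [hflip, h0]
        decide
      · intro v hv
        obtain ⟨hv, h0⟩ := Finset.mem_filter.1 hv
        refine Finset.mem_filter.2 ⟨add_single_mem_delta hA hv, ?_⟩
        rw [hflip, (ZMod.two_eq_zero_or_eq_one _).resolve_left h0]
        decide
    have hsum := Finset.card_filter_add_card_filter_not (s := delta A) (fun v => u ⬝ᵥ v = 0)
    have hpos : 0 < wt A := Finset.card_pos.2 ⟨i, hA⟩
    obtain ⟨k, hk⟩ : ∃ k, wt A = k + 1 := ⟨wt A - 1, by omega⟩
    rw [hhalf, card_delta, hk, pow_succ] at hsum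
    have hcard : ((delta A).filter fun v => u ⬝ᵥ v ≠ 0).card = 2 ^ k := by
      simp only [ne_eq]
      omega
    rw [hcard, hk]
    simp [chi, h]

theorem hwt_cw {m : ℕ} (D : Finset (Fin m → ZMod 2)) (u : Fin m → ZMod 2) :
    hwt (cw D u) = (D.filter fun v => u ⬝ᵥ v ≠ 0).card := by
  refine Finset.card_bij (fun g _ => (g : Fin m → ZMod 2)) ?_
    (fun _ _ _ _ h => Subtype.ext h) ?_
  · intro g hg
    exact Finset.mem_filter.2 ⟨g.2, (Finset.mem_filter.1 hg).2⟩
  · intro v hv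
    obtain ⟨hv, h⟩ := Finset.mem_filter.1 hv
    exact ⟨⟨v, hv⟩, Finset.mem_filter.2 ⟨Finset.mem_univ _, h⟩, rfl⟩

theorem stmt15 {m : ℕ} (A B : Fin m → ZMod 2) (hA : A ≠ 0) (hB : B ≠ 0)
    (hdisj : supp A ∩ supp B = ∅)
    (D : Finset (Fin m → ZMod 2)) (hD : D = (delta A ∪ delta B) \ {0})
    (u : Fin m → ZMod 2) :
    (hwt (cw D u) : ℤ)
      = 2 ^ (wt A - 1) * (1 - chi u A) + 2 ^ (wt B - 1) * (1 - chi u B) := by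
  have hsplit : (D.filter fun v => u ⬝ᵥ v ≠ 0) =
      ((delta A).filter fun v => u ⬝ᵥ v ≠ 0) ∪ ((delta B).filter fun v => u ⬝ᵥ v ≠ 0) := by
    rw [← Finset.filter_union, hD]
    ext v
    simp only [Finset.mem_filter, Finset.mem_sdiff, Finset.mem_singleton]
    refine ⟨fun h => ⟨h.1.1, h.2⟩, fun h => ⟨⟨h.1, ?_⟩, h.2⟩⟩
    rintro rfl
    exact h.2 (dotProduct_zero u)
  have hdisjoint : Disjoint ((delta A).filter fun v => u ⬝ᵥ v ≠ 0)
      ((delta B).filter fun v => u ⬝ᵥ v ≠ 0) := by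
    refine Finset.disjoint_left.2 fun v hvA hvB => ?_
    obtain ⟨hvA, hne⟩ := Finset.mem_filter.1 hvA
    have hv : supp v = ∅ := Finset.subset_empty.1 <| hdisj ▸
      Finset.subset_inter (mem_delta.1 hvA) (mem_delta.1 (Finset.mem_filter.1 hvB).1)
    exact hne (dotProduct_eq_zero_of_supp_disjoint (by rw [hv, Finset.inter_empty]))
  rw [hwt_cw, hsplit, Finset.card_union_of_disjoint hdisjoint, Nat.cast_add,
    card_filter_dotProduct_ne_zero, card_filter_dotProduct_ne_zero]
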